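/- For every natural number n ≥ 10 with n ≡ 4 (mod 6), there exists a set A of 2 partial transformations of an n-element set such that A admits a carefully synchronising word, and every carefully synchronising word for A has length at least 2^((n−4)/3). -/

import Mathlib

/-- Applying a word (list) of partial transformations of `Fin n` to a state `q`,
composing from left to right, with `none` (undefined) propagating. -/
def ptApply {n : ℕ} (w : List (Fin n → Option (Fin n))) (q : Fin n) : Option (Fin n) :=
  w.foldl (fun o f => o.bind f) (some q)

/-- A word `w` over the alphabet `A` is carefully synchronising: all its letters are in `A`
and it maps every state to one common state `q₀`. -/
def CarefullySync {n : ℕ} (A : Finset (Fin n → Option (Fin n)))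
    (w : List (Fin n → Option (Fin n))) : Prop :=
  (∀ g ∈ w, g ∈ A) ∧ ∃ q₀ : Fin n, ∀ q : Fin n, ptApply w q = some q₀

namespace CarLB

/-- States. `L j v`: digit `v` in left cell `j`; `R j 0` / `R j 1`: right cell `j`, ok / bad
(for `j = 0`: freshly swept maximal digit / cell reached while returning);
`E v` (`v < 3`): right cell `0` holding the digit `v`; `E 3`: an additional state. -/
inductive Raw : Type
  | L (j v : ℕ) : Raw
  | R (j x : ℕ) : Raw
  | E (v : ℕ) : Raw

open Raw

def stepA (k : ℕ) : Raw → Option Raw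
  | L 0 v => if v = 3 then some (R 0 0) else some (E v)
  | L (j+1) v => some (L j v)
  | R j x => if j + 1 < k then some (R (j+1) x) else some (R 0 0)
  | E v => if v = 3 then some (L 0 0) else some (R 1 1)

def stepB (k : ℕ) : Raw → Option Raw
  | L j v => if j + 1 < k then some (L (j+1) v) else if v = 3 then some (L j v) else none
  | R 0 _ => some (L 0 0)
  | R (j+1) x => if x = 0 then (if j = 0 then some (R 0 1) else some (R j 0)) else none
  | E v => if v = 3 then none else some (L 0 (v+1))

def step (k : ℕ) (c : Bool) : Raw → Option Raw := if c then stepB k else stepA k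

def run (k : ℕ) (u : List Bool) (o : Option Raw) : Option Raw :=
  u.foldl (fun o c => o.bind (step k c)) o

def Valid (k : ℕ) : Raw → Prop
  | L j v => j < k ∧ v < 4
  | R j x => j < k ∧ x < 2
  | E v => v < 4

def rr (v : ℕ) : Raw := if v = 3 then R 0 0 else E v

def val : List ℕ → ℕ
  | [] => 0
  | d :: l => d + 4 * val l

def Ls (I : Set Raw) (l : List ℕ) : Prop := ∀ j v, l[j]? = some v → L j v ∈ I

def PH (k N : ℕ) (I : Set Raw) : Prop := ∃ l, l.length = k ∧ Ls I l ∧ 2 * val l ≤ N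

def PR (k N : ℕ) (I : Set Raw) : Prop :=
  ∃ m l, l.length + m + 1 = k ∧ Ls I l ∧ R 0 1 ∈ I ∧ (∀ j < m, R (j+1) 0 ∈ I) ∧
    2 * (4^(m+1) * val l) ≤ N

def PA (k N : ℕ) (I : Set Raw) : Prop :=
  ∃ m l v, ∃ y : ℕ → ℕ, l.length + m + 1 = k ∧ Ls I l ∧ rr v ∈ I ∧
    (∀ j < m, R (j+1) (y j) ∈ I) ∧
    ((∃ j < m, y j ≠ 0) ∨ (m + 1 = k ∧ v = 3) ∨
      2 * (4^(m+1) * val l + v * 4^m + 4^m) ≤ N + 1)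

def Inv (k N : ℕ) (I : Set Raw) : Prop := 4^k ≤ N ∨ PH k N I ∨ PR k N I ∨ PA k N I

/-- `J` contains the image of `I` under the letter `f`. -/
def Img (f : Raw → Option Raw) (I J : Set Raw) : Prop :=
  ∀ s ∈ I, ∃ t ∈ J, f s = some t

lemma Img.mem {f : Raw → Option Raw} {I J : Set Raw} (h : Img f I J) {s t : Raw}
    (hs : s ∈ I) (e : f s = some t) : t ∈ J := by
  obtain ⟨t', h1, h2⟩ := h s hs
  rw [e] at h2
  cases h2
  exact h1

lemma top_le : ∀ (l : List ℕ) (j v : ℕ), l[j]? = some v → v * 4^j ≤ val l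
  | [], j, v, h => by simp at h
  | d :: l, 0, v, h => by
      simp at h
      subst h
      simp [val]
  | d :: l, j+1, v, h => by
      simp at h
      have := top_le l j v h
      simp only [val, pow_succ]
      nlinarith

lemma Ls_tail {k : ℕ} {I J : Set Raw} {d : ℕ} {l : List ℕ} (h : Img (stepA k) I J)
    (hl : Ls I (d :: l)) : Ls J l ∧ rr d ∈ J := by
  constructor
  · intro j v hj
    exact h.mem (hl (j+1) v (by simpa using hj)) (by simp [stepA])
  · refine h.mem (hl 0 d (by simp)) ?_
    unfold rr
    simp only [stepA]
    split <;> rfl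

lemma Ls_cons {k : ℕ} {I J : Set Raw} {d : ℕ} {l : List ℕ} (h : Img (stepB k) I J)
    (hl : Ls I l) (hk : l.length < k) (hd : L 0 d ∈ J) : Ls J (d :: l) := by
  intro j v hj
  cases j with
  | zero =>
    simp at hj
    subst hj
    exact hd
  | succ j =>
    simp at hj
    have hlt : j < l.length := by
      by_contra hc
      rw [List.getElem?_eq_none (by omega)] at hj
      cases hj
    refine h.mem (hl j v hj) ?_
    simp only [stepB]
    rw [if_pos (by omega)]

lemma rr_a {k v : ℕ} (hk : 2 ≤ k) : stepA k (rr v) = some (R 1 (if v = 3 then 0 else 1)) := by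
  unfold rr
  split
  · simp only [stepA]
    rw [if_pos (by omega)]
  · simp [stepA, *]

lemma rr_b {k v : ℕ} : stepB k (rr v) = some (L 0 (if v = 3 then 0 else v + 1)) := by
  unfold rr
  split <;> simp [stepB, *]

lemma inv_a {k N : ℕ} {I J : Set Raw} (hk : 2 ≤ k) (h : Img (stepA k) I J)
    (hi : Inv k N I) : Inv k (N+1) J := by
  rcases hi with hN | ⟨l, hlen, hl, hb⟩ | ⟨m, l, hlen, hl, hp, hr, hb⟩ |
    ⟨m, l, v, y, hlen, hl, hv, hr, hb⟩
  · left; omega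
  · right; right; right
    cases l with
    | nil => simp at hlen; omega
    | cons d l =>
      obtain ⟨h1, h2⟩ := Ls_tail h hl
      refine ⟨0, l, d, fun _ => 0, by simpa using hlen, h1, h2, by simp, ?_⟩
      right; right
      simp only [val] at hb
      simp
      omega
  · right; right; right
    have hp' : R 1 1 ∈ J := h.mem hp (by simp only [stepA]; rw [if_pos (by omega)])
    cases l with
    | nil =>
      simp at hlen
      refine ⟨m, [], 3, fun j => if j = 0 then 1 else 0, by simpa using hlen,
        by intro j v hj; simp at hj, ?_, ?_, Or.inr (Or.inl ⟨hlen, rfl⟩)⟩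
      · obtain ⟨m', rfl⟩ : ∃ m', m = m' + 1 := ⟨m - 1, by omega⟩
        refine h.mem (hr m' (by omega)) ?_
        simp only [stepA, rr]
        rw [if_neg (by omega)]; rfl
      · intro j hj
        cases j with
        | zero => simpa using hp'
        | succ j =>
          refine h.mem (hr j (by omega)) ?_
          simp only [stepA]
          rw [if_pos (by omega)]; simp
    | cons d l =>
      obtain ⟨h1, h2⟩ := Ls_tail h hl
      simp at hlen
      refine ⟨m+1, l, d, fun j => if j = 0 then 1 else 0, by omega, h1, h2, ?_,
        Or.inl ⟨0, by omega, by simp⟩⟩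
      intro j hj
      cases j with
      | zero => simpa using hp'
      | succ j =>
        refine h.mem (hr j (by omega)) ?_
        simp only [stepA]
        rw [if_pos (by omega)]; simp
  · right; right; right
    have hv' := h.mem hv (rr_a hk)
    cases l with
    | nil =>
      simp at hlen
      refine ⟨m, [], 3, fun j => if j = 0 then (if v = 3 then 0 else 1) else y (j-1),
        by simpa using hlen,
        by intro j v hj; simp at hj, ?_, ?_, Or.inr (Or.inl ⟨hlen, rfl⟩)⟩
      · obtain ⟨m', rfl⟩ : ∃ m', m = m' + 1 := ⟨m - 1, by omega⟩
        refine h.mem (hr m' (by omega)) ?_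
        simp only [stepA, rr]
        rw [if_neg (by omega)]; rfl
      · intro j hj
        cases j with
        | zero => simpa using hv'
        | succ j =>
          refine h.mem (hr j (by omega)) ?_
          simp only [stepA]
          rw [if_pos (by omega)]; simp
    | cons d l =>
      obtain ⟨h1, h2⟩ := Ls_tail h hl
      simp at hlen
      refine ⟨m+1, l, d, fun j => if j = 0 then (if v = 3 then 0 else 1) else y (j-1),
        by omega, h1, h2, ?_, ?_⟩
      · intro j hj
        cases j with
        | zero => simpa using hv'
        | succ j =>
          refine h.mem (hr j (by omega)) ?_
          simp only [stepA]
          rw [if_pos (by omega)]; simp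
      · rcases hb with ⟨j, hj, hy⟩ | ⟨h3, _⟩ | hb
        · exact Or.inl ⟨j+1, by omega, by simpa using hy⟩
        · omega
        · by_cases h3 : v = 3
          · right; right
            subst h3
            simp only [val] at hb
            have e : 2 * (4^(m+1+1) * val l + d * 4^(m+1) + 4^(m+1))
              = 2 * (4^(m+1) * (d + 4 * val l) + 3 * 4^m + 4^m) := by ring
            omega
          · exact Or.inl ⟨0, by omega, by simp [h3]⟩

lemma ret_or_home {k N m : ℕ} {J : Set Raw} {l : List ℕ} (hlen : l.length + m = k)
    (hl : Ls J l) (h0 : 0 < m → R 0 1 ∈ J) (hr : ∀ j, j + 1 < m → R (j+1) 0 ∈ J)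
    (hb : 2 * (4^m * val l) ≤ N) : Inv k N J := by
  cases m with
  | zero => exact Or.inr (Or.inl ⟨l, by simpa using hlen, hl, by simpa using hb⟩)
  | succ m =>
    exact Or.inr (Or.inr (Or.inl ⟨m, l, by omega, hl, h0 (by omega),
      fun j hj => hr j (by omega), hb⟩))

lemma inv_b {k N : ℕ} {I J : Set Raw} (hk : 2 ≤ k) (h : Img (stepB k) I J)
    (hi : Inv k N I) : Inv k (N+1) J := by
  rcases hi with hN | ⟨l, hlen, hl, hb⟩ | ⟨m, l, hlen, hl, hp, hr, hb⟩ |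
    ⟨m, l, v, y, hlen, hl, hv, hr, hb⟩
  · left; omega
  · left
    obtain ⟨k', rfl⟩ : ∃ k', k = k' + 1 := ⟨k - 1, by omega⟩
    have hg : l[k']? = some l[k'] := List.getElem?_eq_getElem (by omega)
    obtain ⟨t, _, ht⟩ := h _ (hl _ _ hg)
    simp only [stepB] at ht
    rw [if_neg (by omega)] at ht
    have h3 : l[k'] = 3 := by
      by_contra hc
      rw [if_neg hc] at ht
      cases ht
    rw [h3] at hg
    have := top_le _ _ _ hg
    rw [pow_succ]
    omega
  · have h0 : L 0 0 ∈ J := h.mem hp (by simp [stepB])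
    refine ret_or_home (m := m) (l := 0 :: l) (by simp; omega)
      (Ls_cons h hl (by omega) h0) ?_ ?_ ?_
    · intro hm
      exact h.mem (hr 0 hm) (by simp [stepB])
    · intro j hj
      exact h.mem (hr (j+1) hj) (by simp [stepB])
    · simp only [val]
      have e : 2 * (4^m * (0 + 4 * val l)) = 2 * (4^(m+1) * val l) := by ring
      omega
  · have hv' := h.mem hv rr_b
    have hy : ∀ j < m, y j = 0 := by
      intro j hj
      obtain ⟨t, _, ht⟩ := h _ (hr j hj)
      by_contra hc
      simp [stepB, hc] at ht
    refine ret_or_home (m := m) (by simp; omega)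
      (Ls_cons h hl (by omega) hv') ?_ ?_ ?_
    · intro hm
      exact h.mem (hr 0 hm) (by simp [stepB, hy 0 hm])
    · intro j hj
      exact h.mem (hr (j+1) hj) (by simp [stepB, hy (j+1) hj])
    · rcases hb with ⟨j, hj, hne⟩ | ⟨h1, h2⟩ | hb
      · exact absurd (hy j hj) hne
      · have : l = [] := List.length_eq_zero_iff.mp (by omega)
        subst this
        simp [val, h2]
      · have e : 2 * (4^m * ((v+1) + 4 * val l))
            = 2 * (4^(m+1) * val l + v * 4^m + 4^m) := by ring
        have h2 : 2 * (4^m * ((if v = 3 then 0 else v + 1) + 4 * val l))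
            ≤ 2 * (4^m * ((v+1) + 4 * val l)) := by
          gcongr
          split <;> omega
        simp only [val]
        omega

lemma inv_two {k N : ℕ} {I : Set Raw} (hk : 2 ≤ k) (hi : Inv k N I)
    (hs : ∀ s ∈ I, ∀ t ∈ I, s = t) : 4^k ≤ N := by
  rcases hi with hN | ⟨l, hlen, hl, hb⟩ | ⟨m, l, hlen, hl, hp, hr, hb⟩ |
    ⟨m, l, v, y, hlen, hl, hv, hr, hb⟩
  · exact hN
  · have := hs _ (hl 0 _ (List.getElem?_eq_getElem (by omega))) _
      (hl 1 _ (List.getElem?_eq_getElem (by omega)))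
    simp at this
  · cases m with
    | zero =>
      have := hs _ hp _ (hl 0 _ (List.getElem?_eq_getElem (by omega)))
      simp at this
    | succ m =>
      have := hs _ hp _ (hr 0 (by omega))
      simp at this
  · cases m with
    | zero =>
      have := hs _ hv _ (hl 0 _ (List.getElem?_eq_getElem (by omega)))
      unfold rr at this
      split at this <;> simp at this
    | succ m =>
      have := hs _ hv _ (hr 0 (by omega))
      unfold rr at this
      split at this <;> simp at this

lemma run_append (k : ℕ) (u v : List Bool) (o : Option Raw) :
    run k (u ++ v) o = run k v (run k u o) := by
  simp [run]

lemma run_none (k : ℕ) (u : List Bool) : run k u none = none := by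
  induction u with
  | nil => rfl
  | cons c u ih => simpa [run] using ih

def image (k : ℕ) (u : List Bool) : Set Raw := {t | ∃ s, Valid k s ∧ run k u (some s) = some t}

lemma inv_run {k : ℕ} (hk : 2 ≤ k) (u : List Bool) :
    (∀ s, Valid k s → ∃ t, run k u (some s) = some t) → Inv k u.length (image k u) := by
  induction u using List.reverseRecOn with
  | nil =>
    intro _
    right; right; right
    refine ⟨k-1, [], 3, fun _ => 0, by simp; omega, by intro j v hj; simp at hj, ?_, ?_,
      Or.inr (Or.inl ⟨by omega, rfl⟩)⟩
    · exact ⟨R 0 0, ⟨by omega, by omega⟩, rfl⟩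
    · intro j hj
      exact ⟨R (j+1) 0, ⟨by omega, by omega⟩, rfl⟩
  | append_singleton u c ih =>
    intro hd
    have hd' : ∀ s, Valid k s → ∃ t, run k u (some s) = some t := by
      intro s hs
      obtain ⟨t, ht⟩ := hd s hs
      rw [run_append] at ht
      cases e : run k u (some s) with
      | none => rw [e, run_none] at ht; cases ht
      | some t' => exact ⟨t', rfl⟩
    have hinv := ih hd'
    have him : Img (step k c) (image k u) (image k (u ++ [c])) := by
      rintro t ⟨s, hs, e⟩
      obtain ⟨t', ht'⟩ := hd s hs
      refine ⟨t', ⟨s, hs, ht'⟩, ?_⟩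
      rw [run_append, e] at ht'
      simpa [run] using ht'
    rw [List.length_append]
    cases c with
    | false => exact inv_a hk him hinv
    | true => exact inv_b hk him hinv

theorem lower {k : ℕ} (hk : 2 ≤ k) (u : List Bool) (t : Raw)
    (h : ∀ s, Valid k s → run k u (some s) = some t) : 4^k ≤ u.length := by
  refine inv_two hk (inv_run hk u (fun s hs => ⟨t, h s hs⟩)) ?_
  rintro a ⟨s, hs, e⟩ b ⟨s', hs', e'⟩
  rw [h s hs] at e
  rw [h s' hs'] at e'
  cases e; cases e'; rfl

/-! Existence of a synchronising word. -/

def Go (k : ℕ) (P Q : Set Raw) : Prop := ∃ u, ∀ s ∈ P, ∃ t ∈ Q, run k u (some s) = some t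

lemma Go.trans {k : ℕ} {P Q S : Set Raw} (h : Go k P Q) (h' : Go k Q S) : Go k P S := by
  obtain ⟨u, hu⟩ := h
  obtain ⟨v, hv⟩ := h'
  refine ⟨u ++ v, fun s hs => ?_⟩
  obtain ⟨t, ht, e⟩ := hu s hs
  obtain ⟨t', ht', e'⟩ := hv t ht
  exact ⟨t', ht', by rw [run_append, e, e']⟩

lemma Go.of_subset {k : ℕ} {P Q : Set Raw} (h : ∀ s ∈ P, s ∈ Q) : Go k P Q :=
  ⟨[], fun s hs => ⟨s, h s hs, rfl⟩⟩

lemma Go.a {k : ℕ} {P Q : Set Raw} (h : Img (stepA k) P Q) : Go k P Q :=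
  ⟨[false], fun s hs => by simpa [run, step] using h s hs⟩

lemma Go.b {k : ℕ} {P Q : Set Raw} (h : Img (stepB k) P Q) : Go k P Q :=
  ⟨[true], fun s hs => by simpa [run, step] using h s hs⟩

def mu (k : ℕ) : Raw → ℕ
  | L j _ => k + 1 + j
  | R j x => if x = 0 then 0 else k - j
  | E v => if v = 3 then k + 2 else k

lemma go_core {k : ℕ} (hk : 2 ≤ k) (c : ℕ) :
    Go k {s | Valid k s ∧ mu k s ≤ c} {s | Valid k s ∧ mu k s ≤ 0} := by
  induction c with
  | zero => exact Go.of_subset fun s hs => hs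
  | succ c ih =>
    refine Go.trans (Go.a ?_) ih
    rintro s ⟨hv, hm⟩
    match s, hv, hm with
    | L 0 v, hv, hm =>
      simp only [Valid, mu] at hv hm
      by_cases h3 : v = 3
      · exact ⟨R 0 0, ⟨⟨by omega, by omega⟩, by simp [mu]⟩, by simp [stepA, h3]⟩
      · refine ⟨E v, ⟨hv.2, ?_⟩, by simp [stepA, h3]⟩
        simp only [mu]
        rw [if_neg h3]; omega
    | L (j+1) v, hv, hm =>
      simp only [Valid, mu] at hv hm
      exact ⟨L j v, ⟨⟨by omega, hv.2⟩, by simp only [mu]; omega⟩, by simp [stepA]⟩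
    | R j x, hv, hm =>
      simp only [Valid, mu] at hv hm
      by_cases h1 : j + 1 < k
      · refine ⟨R (j+1) x, ⟨⟨h1, hv.2⟩, ?_⟩, by simp [stepA, h1]⟩
        simp only [mu]
        split
        · omega
        · rw [if_neg (by assumption)] at hm
          omega
      · exact ⟨R 0 0, ⟨⟨by omega, by omega⟩, by simp [mu]⟩, by simp [stepA, h1]⟩
    | E v, hv, hm =>
      simp only [Valid, mu] at hv hm
      by_cases h3 : v = 3
      · rw [if_pos h3] at hm
        exact ⟨L 0 0, ⟨⟨by omega, by omega⟩, by simp only [mu]; omega⟩, by simp [stepA, h3]⟩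
      · rw [if_neg h3] at hm
        refine ⟨R 1 1, ⟨⟨by omega, by omega⟩, ?_⟩, by simp [stepA, h3]⟩
        simp only [mu]
        rw [if_neg (by omega)]; omega

def HomeSet (l : List ℕ) : Set Raw := {s | ∃ j v, l[j]? = some v ∧ s = L j v}

def RetSet (m : ℕ) (l : List ℕ) : Set Raw :=
  {s | (0 < m ∧ s = R 0 1) ∨ (∃ j, j + 1 < m ∧ s = R (j+1) 0) ∨ s ∈ HomeSet l}

def SwSet (m v : ℕ) (l : List ℕ) : Set Raw :=
  {s | s = rr v ∨ (∃ j < m, s = R (j+1) 0) ∨ s ∈ HomeSet l}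

lemma home_a {k d : ℕ} {l : List ℕ} {s : Raw} (h : s ∈ HomeSet (d :: l)) :
    ∃ t, (t = rr d ∨ t ∈ HomeSet l) ∧ stepA k s = some t := by
  obtain ⟨j, v, hj, rfl⟩ := h
  cases j with
  | zero =>
    simp at hj
    subst hj
    refine ⟨rr d, Or.inl rfl, ?_⟩
    unfold rr
    simp only [stepA]
    split <;> rfl
  | succ j => exact ⟨L j v, Or.inr ⟨j, v, by simpa using hj, rfl⟩, by simp [stepA]⟩

lemma home_b {k d : ℕ} {l : List ℕ} {s : Raw} (hk : l.length < k) (h : s ∈ HomeSet l) :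
    ∃ t, t ∈ HomeSet (d :: l) ∧ stepB k s = some t := by
  obtain ⟨j, v, hj, rfl⟩ := h
  refine ⟨L (j+1) v, ⟨j+1, v, by simpa using hj, rfl⟩, ?_⟩
  have hlt : j < l.length := by
    by_contra hc
    rw [List.getElem?_eq_none (by omega)] at hj
    cases hj
  simp only [stepB]
  rw [if_pos (by omega)]

lemma go_ret {k : ℕ} (m : ℕ) : ∀ l : List ℕ, l.length + m ≤ k →
    Go k (RetSet m l) (HomeSet (List.replicate m 0 ++ l)) := by
  induction m with
  | zero =>
    intro l _
    refine Go.of_subset ?_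
    rintro s (h | ⟨j, h, _⟩ | h)
    · omega
    · omega
    · simpa using h
  | succ m ih =>
    intro l hl
    have h2 := ih (0 :: l) (by simp; omega)
    have e : List.replicate (m+1) 0 ++ l = List.replicate m 0 ++ (0 :: l) := by
      rw [List.replicate_succ']; simp
    rw [e]
    refine Go.trans (Go.b ?_) h2
    rintro s (⟨_, rfl⟩ | ⟨j, h, rfl⟩ | h)
    · exact ⟨L 0 0, Or.inr (Or.inr ⟨0, 0, by simp, rfl⟩), by simp [stepB]⟩
    · cases j with
      | zero => exact ⟨R 0 1, Or.inl ⟨by omega, rfl⟩, by simp [stepB]⟩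
      | succ j => exact ⟨R (j+1) 0, Or.inr (Or.inl ⟨j, by omega, rfl⟩), by simp [stepB]⟩
    · obtain ⟨t, ht, e⟩ := home_b (k := k) (d := 0) (by omega) h
      exact ⟨t, Or.inr (Or.inr ht), e⟩

lemma go_sweep {k : ℕ} (hk : 2 ≤ k) (m : ℕ) : ∀ (i v : ℕ) (l : List ℕ),
    l.length + i + m + 2 ≤ k →
    Go k (SwSet i 3 (List.replicate m 3 ++ v :: l)) (SwSet (i+m+1) v l) := by
  induction m with
  | zero =>
    intro i v l hl
    refine Go.a ?_
    rintro s (rfl | ⟨j, h, rfl⟩ | h)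
    · exact ⟨R 1 0, Or.inr (Or.inl ⟨0, by omega, rfl⟩), by rw [rr_a hk]; rfl⟩
    · refine ⟨R (j+2) 0, Or.inr (Or.inl ⟨j+1, by omega, rfl⟩), ?_⟩
      simp only [stepA]
      rw [if_pos (by omega)]
    · obtain ⟨t, ht | ht, e⟩ := home_a (k := k) (by simpa using h)
      · exact ⟨t, Or.inl ht, e⟩
      · exact ⟨t, Or.inr (Or.inr ht), e⟩
  | succ m ih =>
    intro i v l hl
    have h2 := ih (i+1) v l (by omega)
    have e : i + 1 + m + 1 = i + (m+1) + 1 := by omega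
    rw [e] at h2
    refine Go.trans (Go.a ?_) h2
    rintro s (rfl | ⟨j, h, rfl⟩ | h)
    · exact ⟨R 1 0, Or.inr (Or.inl ⟨0, by omega, rfl⟩), by rw [rr_a hk]; rfl⟩
    · refine ⟨R (j+2) 0, Or.inr (Or.inl ⟨j+1, by omega, rfl⟩), ?_⟩
      simp only [stepA]
      rw [if_pos (by omega)]
    · rw [List.replicate_succ, List.cons_append] at h
      obtain ⟨t, ht | ht, e⟩ := home_a (k := k) h
      · exact ⟨t, Or.inl ht, e⟩
      · exact ⟨t, Or.inr (Or.inr ht), e⟩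

lemma go_up {k : ℕ} (hk : 2 ≤ k) (m v : ℕ) (l : List ℕ) (hl : l.length + m + 1 ≤ k) :
    Go k (HomeSet (List.replicate m 3 ++ v :: l)) (SwSet m v l) := by
  cases m with
  | zero =>
    refine Go.a ?_
    intro s h
    obtain ⟨t, ht | ht, e⟩ := home_a (k := k) (by simpa using h)
    · exact ⟨t, Or.inl ht, e⟩
    · exact ⟨t, Or.inr (Or.inr ht), e⟩
  | succ m =>
    have h2 := go_sweep hk m 0 v l (by omega)
    have e : 0 + m + 1 = m + 1 := by omega
    rw [e] at h2
    refine Go.trans (Go.a ?_) h2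
    intro s h
    rw [List.replicate_succ, List.cons_append] at h
    obtain ⟨t, ht | ht, e⟩ := home_a (k := k) h
    · exact ⟨t, Or.inl ht, e⟩
    · exact ⟨t, Or.inr (Or.inr ht), e⟩

lemma go_inc {k : ℕ} (hk : 2 ≤ k) (m v : ℕ) (l : List ℕ) (hl : l.length + m + 1 ≤ k)
    (hv : v ≠ 3) :
    Go k (HomeSet (List.replicate m 3 ++ v :: l))
      (HomeSet (List.replicate m 0 ++ (v+1) :: l)) := by
  refine Go.trans (go_up hk m v l hl) (Go.trans (Go.b ?_) (go_ret m ((v+1) :: l)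
    (by simp; omega)))
  rintro s (rfl | ⟨j, h, rfl⟩ | h)
  · exact ⟨L 0 (v+1), Or.inr (Or.inr ⟨0, v+1, by simp, rfl⟩), by rw [rr_b, if_neg hv]⟩
  · cases j with
    | zero => exact ⟨R 0 1, Or.inl ⟨by omega, rfl⟩, by simp [stepB]⟩
    | succ j => exact ⟨R (j+1) 0, Or.inr (Or.inl ⟨j, by omega, rfl⟩), by simp [stepB]⟩
  · obtain ⟨t, ht, e⟩ := home_b (k := k) (d := v+1) (by omega) h
    exact ⟨t, Or.inr (Or.inr ht), e⟩

lemma go_count {k : ℕ} (hk : 2 ≤ k) (t : ℕ) : ∀ l : List ℕ, l.length + t ≤ k →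
    Go k (HomeSet (List.replicate t 0 ++ l)) (HomeSet (List.replicate t 3 ++ l)) := by
  induction t with
  | zero => exact fun l _ => Go.of_subset fun s h => h
  | succ t ih =>
    intro l hl
    have e : ∀ x : ℕ, List.replicate (t+1) x ++ l = List.replicate t x ++ (x :: l) := by
      intro x
      rw [List.replicate_succ']; simp
    rw [e, e]
    have h1 : ∀ v, Go k (HomeSet (List.replicate t 0 ++ v :: l))
        (HomeSet (List.replicate t 3 ++ v :: l)) := fun v => ih (v :: l) (by simp; omega)
    have h2 : ∀ v, v ≠ 3 → Go k (HomeSet (List.replicate t 3 ++ v :: l))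
        (HomeSet (List.replicate t 0 ++ (v+1) :: l)) :=
      fun v hv => go_inc hk t v l (by omega) hv
    exact ((((((h1 0).trans (h2 0 (by omega))).trans (h1 1)).trans (h2 1 (by omega))).trans
      (h1 2)).trans (h2 2 (by omega))).trans (h1 3)

lemma go_end {k : ℕ} (c : ℕ) :
    Go k {s | ∃ j, j < k ∧ k ≤ j + 1 + c ∧ s = L j 3} {s | s = L (k-1) 3} := by
  induction c with
  | zero =>
    refine Go.of_subset ?_
    rintro s ⟨j, h1, h2, rfl⟩
    have : j = k - 1 := by omega
    subst this
    rfl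
  | succ c ih =>
    refine Go.trans (Go.b ?_) ih
    rintro s ⟨j, h1, h2, rfl⟩
    by_cases h : j + 1 < k
    · exact ⟨L (j+1) 3, ⟨j+1, h, by omega, rfl⟩, by simp [stepB, h]⟩
    · exact ⟨L j 3, ⟨j, h1, by omega, rfl⟩, by simp [stepB, h]⟩

theorem upper {k : ℕ} (hk : 2 ≤ k) :
    ∃ u, ∀ s, Valid k s → run k u (some s) = some (L (k-1) 3) := by
  have g1 : Go k {s | Valid k s} {s | Valid k s ∧ mu k s ≤ 0} := by
    refine Go.trans (Go.of_subset ?_) (go_core hk (2 * k + 2))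
    intro s hs
    refine ⟨hs, ?_⟩
    have hs' : Valid k s := hs
    clear hs
    cases s <;> simp only [Valid, mu] at hs' ⊢
    · omega
    · split <;> omega
    · split <;> omega
  have g2 : Go k {s | Valid k s ∧ mu k s ≤ 0} (RetSet (k-1) [0]) := by
    refine Go.b ?_
    rintro s ⟨hv, hm⟩
    match s, hv, hm with
    | L j v, hv, hm => simp only [mu] at hm; omega
    | E v, hv, hm =>
      simp only [mu] at hm
      split at hm <;> omega
    | R 0 x, hv, hm => exact ⟨L 0 0, Or.inr (Or.inr ⟨0, 0, by simp, rfl⟩), by simp [stepB]⟩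
    | R (j+1) x, hv, hm =>
      simp only [mu, Valid] at hm hv
      have hx : x = 0 := by
        by_contra hc
        rw [if_neg hc] at hm
        omega
      subst hx
      cases j with
      | zero => exact ⟨R 0 1, Or.inl ⟨by omega, rfl⟩, by simp [stepB]⟩
      | succ j => exact ⟨R (j+1) 0, Or.inr (Or.inl ⟨j, by omega, rfl⟩), by simp [stepB]⟩
  have g3 := go_ret (k := k) (k-1) [0] (by simp; omega)
  have e : List.replicate (k-1) 0 ++ [0] = List.replicate k 0 ++ [] := by
    rw [← List.replicate_succ', List.append_nil]
    congr 1
    omega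
  rw [e] at g3
  have g4 := go_count hk k [] (by simp)
  have g5 : Go k (HomeSet (List.replicate k 3 ++ [])) {s | s = L (k-1) 3} := by
    refine Go.trans (Go.of_subset ?_) (go_end k)
    rintro s ⟨j, v, hj, rfl⟩
    rw [List.append_nil, List.getElem?_replicate] at hj
    split at hj
    · cases hj
      exact ⟨j, by assumption, by omega, rfl⟩
    · cases hj
  obtain ⟨u, hu⟩ := (((g1.trans g2).trans g3).trans g4).trans g5
  refine ⟨u, fun s hs => ?_⟩
  obtain ⟨t, ht, e⟩ := hu s hs
  rw [e, ht]

/-! Transfer to `Fin n`. -/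

def enc (k : ℕ) : Raw → ℕ
  | L j v => 6 * j + v
  | R j x => 6 * j + 4 + x
  | E v => 6 * k + v

def dec (k q : ℕ) : Raw :=
  if q < 6 * k then (if q % 6 < 4 then L (q / 6) (q % 6) else R (q / 6) (q % 6 - 4))
  else E (q - 6 * k)

lemma enc_lt {k : ℕ} {s : Raw} (h : Valid k s) : enc k s < 6 * k + 4 := by
  cases s <;> simp only [Valid, enc] at * <;> omega

lemma dec_valid {k q : ℕ} (h : q < 6 * k + 4) : Valid k (dec k q) := by
  unfold dec
  split_ifs <;> simp only [Valid] <;> omega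

lemma dec_enc {k : ℕ} {s : Raw} (h : Valid k s) : dec k (enc k s) = s := by
  cases s with
  | L j v =>
    simp only [Valid] at h
    show dec k (6 * j + v) = L j v
    unfold dec
    rw [if_pos (by omega), if_pos (by omega)]
    congr 1 <;> omega
  | R j x =>
    simp only [Valid] at h
    show dec k (6 * j + 4 + x) = R j x
    unfold dec
    rw [if_pos (by omega), if_neg (by omega)]
    congr 1 <;> omega
  | E v =>
    simp only [Valid] at h
    show dec k (6 * k + v) = E v
    unfold dec
    rw [if_neg (by omega)]
    congr 1
    omega

lemma valid_stepA {k : ℕ} (hk : 2 ≤ k) {s t : Raw} (h : Valid k s)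
    (e : stepA k s = some t) : Valid k t := by
  match s, h, e with
  | L 0 v, h, e =>
    simp only [stepA, Valid] at h e
    split at e <;> cases e <;> simp only [Valid] <;> omega
  | L (j+1) v, h, e =>
    simp only [stepA, Valid] at h e
    cases e
    simp only [Valid]; omega
  | R j x, h, e =>
    simp only [stepA, Valid] at h e
    split at e <;> cases e <;> simp only [Valid] <;> omega
  | E v, h, e =>
    simp only [stepA, Valid] at h e
    split at e <;> cases e <;> simp only [Valid] <;> omega

lemma valid_stepB {k : ℕ} (hk : 2 ≤ k) {s t : Raw} (h : Valid k s)
    (e : stepB k s = some t) : Valid k t := by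
  match s, h, e with
  | L j v, h, e =>
    simp only [stepB, Valid] at h e
    split at e
    · cases e; simp only [Valid]; omega
    · split at e
      · cases e; simp only [Valid]; omega
      · cases e
  | R 0 x, h, e =>
    simp only [stepB, Valid] at h e
    cases e
    simp only [Valid]; omega
  | R (j+1) x, h, e =>
    simp only [stepB, Valid] at h e
    split at e
    · split at e <;> cases e <;> simp only [Valid] <;> omega
    · cases e
  | E v, h, e =>
    simp only [stepB, Valid] at h e
    split at e
    · cases e
    · cases e; simp only [Valid]; omega

lemma valid_step {k : ℕ} (hk : 2 ≤ k) (c : Bool) {s t : Raw} (h : Valid k s)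
    (e : step k c s = some t) : Valid k t := by
  cases c with
  | false => exact valid_stepA hk h e
  | true => exact valid_stepB hk h e

def toFin (k : ℕ) (s : Raw) : Fin (6 * k + 4) := ⟨enc k s % (6 * k + 4), Nat.mod_lt _ (by omega)⟩

lemma toFin_val {k : ℕ} {s : Raw} (h : Valid k s) : (toFin k s).1 = enc k s :=
  Nat.mod_eq_of_lt (enc_lt h)

def tr (k : ℕ) (c : Bool) (q : Fin (6 * k + 4)) : Option (Fin (6 * k + 4)) :=
  (step k c (dec k q.1)).map (toFin k)

lemma toFin_dec {k : ℕ} (q : Fin (6 * k + 4)) : toFin k (dec k q.1) = q := by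
  apply Fin.ext
  rw [toFin_val (dec_valid q.2)]
  have := q.2
  unfold dec
  split_ifs <;> simp only [enc] <;> omega

lemma fold_tr {k : ℕ} (hk : 2 ≤ k) (u : List Bool) : ∀ o : Option Raw,
    (∀ s, o = some s → Valid k s) →
    (u.map (tr k)).foldl (fun o f => o.bind f) (o.map (toFin k)) = (run k u o).map (toFin k) ∧
    (∀ s, run k u o = some s → Valid k s) := by
  induction u with
  | nil => exact fun o h => ⟨rfl, h⟩
  | cons c u ih =>
    intro o h
    have h2 := ih (o.bind (step k c)) (by
      intro t ht
      cases o with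
      | none => cases ht
      | some s => exact valid_step hk c (h s rfl) ht)
    refine ⟨?_, h2.2⟩
    rw [List.map_cons, List.foldl_cons]
    have e : (o.map (toFin k)).bind (tr k c) = (o.bind (step k c)).map (toFin k) := by
      cases o with
      | none => rfl
      | some s =>
        have hs := h s rfl
        simp [tr, toFin_val hs, dec_enc hs]
    rw [e]
    exact h2.1

lemma letters {α : Type*} (f : Bool → α) (w : List α) (h : ∀ g ∈ w, g = f false ∨ g = f true) :
    ∃ u : List Bool, w = u.map f := by
  induction w with
  | nil => exact ⟨[], rfl⟩
  | cons g w ih =>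
    obtain ⟨u, rfl⟩ := ih fun g hg => h g (List.mem_cons_of_mem _ hg)
    rcases h g List.mem_cons_self with rfl | rfl
    · exact ⟨false :: u, rfl⟩
    · exact ⟨true :: u, rfl⟩

end CarLB

open CarLB in
theorem CarLB.main_case (k : ℕ) (hk : 2 ≤ k) :
    ∃ A : Finset (Fin (6 * k + 4) → Option (Fin (6 * k + 4))),
      A.card = 2 ∧
      (∃ w, CarefullySync A w) ∧
      (∀ w, CarefullySync A w → 4 ^ k ≤ w.length) := by
  classical
  have hrun : ∀ (u : List Bool) (q : Fin (6 * k + 4)),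
      ptApply (u.map (tr k)) q = (run k u (some (dec k q.1))).map (toFin k) ∧
      (∀ s, run k u (some (dec k q.1)) = some s → Valid k s) := by
    intro u q
    have := fold_tr hk u (some (dec k q.1)) (by
      intro s hs
      cases hs
      exact dec_valid q.2)
    rw [Option.map_some, toFin_dec] at this
    exact this
  refine ⟨{tr k false, tr k true}, ?_, ?_, ?_⟩
  · rw [Finset.card_pair]
    intro h
    have hv : Valid k (Raw.E 3) := by simp [Valid]
    have := congrFun h (toFin k (Raw.E 3))
    simp [tr, toFin_val hv, dec_enc hv, step, stepA, stepB] at this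
  · obtain ⟨u, hu⟩ := upper hk
    refine ⟨u.map (tr k), ?_, toFin k (Raw.L (k-1) 3), ?_⟩
    · intro g hg
      obtain ⟨c, _, rfl⟩ := List.mem_map.mp hg
      cases c <;> simp
    · intro q
      rw [(hrun u q).1, hu _ (dec_valid q.2)]
      rfl
  · rintro w ⟨hw, q₀, hq⟩
    obtain ⟨u, rfl⟩ := letters (tr k) w (by simpa using hw)
    rw [List.length_map]
    refine lower hk u (dec k q₀.1) ?_
    intro s hs
    have h1 := hq (toFin k s)
    have h2 := hrun u (toFin k s)
    rw [toFin_val hs, dec_enc hs] at h2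
    rw [h2.1] at h1
    cases e : run k u (some s) with
    | none => rw [e] at h1; cases h1
    | some t =>
      rw [e] at h1
      have ht := h2.2 t e
      simp only [Option.map_some, Option.some.injEq] at h1
      rw [← h1, toFin_val ht, dec_enc ht]

theorem CarLB.small_case :
    ∃ A : Finset (Fin 10 → Option (Fin 10)),
      A.card = 2 ∧
      (∃ w, CarefullySync A w) ∧
      (∀ w, CarefullySync A w → 4 ≤ w.length) := by
  classical
  let f : Fin 10 → Option (Fin 10) := fun q => some ⟨min (q.1 + 1) 9, by omega⟩
  let g : Fin 10 → Option (Fin 10) := fun _ => none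
  refine ⟨{f, g}, ?_, ⟨List.replicate 9 f, ?_, 9, ?_⟩, ?_⟩
  · rw [Finset.card_pair]
    intro h
    have := congrFun h 0
    simp [f, g] at this
  · intro x hx
    rw [List.eq_of_mem_replicate hx]
    simp
  · intro q
    have aux : ∀ (m : ℕ) (q : Fin 10),
        ptApply (List.replicate m f) q = some ⟨min (q.1 + m) 9, by omega⟩ := by
      intro m
      induction m with
      | zero =>
        intro q
        have hq := q.2
        show some q = _
        congr 1
        apply Fin.ext
        show q.1 = min (q.1 + 0) 9
        omega
      | succ m ih =>
        intro q
        rw [List.replicate_succ]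
        show ptApply (List.replicate m f) ⟨min (q.1 + 1) 9, by omega⟩ = _
        rw [ih]
        congr 1
        apply Fin.ext
        show min (min (q.1 + 1) 9 + m) 9 = min (q.1 + (m + 1)) 9
        omega
    rw [aux]
    congr 1
    apply Fin.ext
    show min (q.1 + 9) 9 = 9
    omega
  · rintro w ⟨hw, q₀, hq⟩
    have key : ∀ (w : List (Fin 10 → Option (Fin 10))), (∀ x ∈ w, x = f ∨ x = g) →
        ∀ (a r : Fin 10), ptApply w a = some r → r.1 ≤ a.1 + w.length ∧ a.1 ≤ r.1 := by
      intro w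
      induction w with
      | nil =>
        intro _ a r h
        simp [ptApply] at h
        subst h
        simp
      | cons x w ih =>
        intro hx a r h
        rcases hx x List.mem_cons_self with rfl | rfl
        · have h' : ptApply w ⟨min (a.1 + 1) 9, by omega⟩ = some r := h
          have := ih (fun y hy => hx y (List.mem_cons_of_mem _ hy)) _ _ h'
          simp only [List.length_cons]
          simp only at this
          omega
        · exfalso
          have hn : ∀ w : List (Fin 10 → Option (Fin 10)),
              w.foldl (fun o f => o.bind f) none = none := by
            intro w
            induction w with
            | nil => rfl
            | cons y w ih => simpa using ih
          have h' : w.foldl (fun o f => o.bind f) none = some r := h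
          rw [hn] at h'
          cases h'
    have hw' : ∀ x ∈ w, x = f ∨ x = g := by simpa using hw
    have h0 := key w hw' 0 q₀ (hq 0)
    have h9 := key w hw' 9 q₀ (hq 9)
    have e0 : (0 : Fin 10).1 = 0 := rfl
    have e9 : (9 : Fin 10).1 = 9 := rfl
    omega

/-- For every `n ≥ 10` with `n ≡ 4 (mod 6)`, there is an alphabet of `2` partial
transformations of an `n`-element set admitting a carefully synchronising word, all of whose
carefully synchronising words have length at least `2 ^ ((n - 4) / 3)`. -/
theorem car_lower_bound_binary (n : ℕ) (hn : 10 ≤ n) (hmod : n % 6 = 4) :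
    ∃ A : Finset (Fin n → Option (Fin n)),
      A.card = 2 ∧
      (∃ w, CarefullySync A w) ∧
      (∀ w, CarefullySync A w → 2 ^ ((n - 4) / 3) ≤ w.length) := by
  obtain ⟨k, rfl⟩ : ∃ k, n = 6 * k + 4 := ⟨n / 6, by omega⟩
  have e : (6 * k + 4 - 4) / 3 = 2 * k := by omega
  rw [e, pow_mul]
  by_cases hk : 2 ≤ k
  · exact CarLB.main_case k hk
  · have h1 : k = 1 := by omega
    subst h1
    exact CarLB.small_case
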